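/- arXiv:2001.04004 — 2 statements merged into one kernel-verified Lean document; each statement's English description precedes it below -/
import Mathlib

section
/- For all i, j with 0 ≤ i, j ≤ a2: the k-vector space Hom(M(r_i), M(r_j)) is zero if j ≡ i+1 (mod a2+1), and has dimension 1 otherwise. In particular every endomorphism of M(r_i) is a scalar multiple of the identity. -/
inductive V (a1 a2 : ℕ) : Type where
  | r : Fin (a2 + 1) → V a1 a2
  | s : Fin (a1 - 1) → V a1 a2
  | t : Fin (a1 - 1) → V a1 a2

def Arrow (a1 a2 : ℕ) : V a1 a2 → V a1 a2 → Prop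
  | .r i, .r j => ((i : ℕ) + 1 = (j : ℕ)) ∨ ((i : ℕ) = a2 ∧ (j : ℕ) = 0)
  | .s i, .s j => (i : ℕ) + 1 = (j : ℕ)
  | .s i, .r j => (i : ℕ) = a1 - 2 ∧ (j : ℕ) = a2
  | .r i, .t j => (i : ℕ) = 0 ∧ (j : ℕ) = 0
  | .t i, .t j => (i : ℕ) + 1 = (j : ℕ)
  | _, _ => False

structure Repn (k : Type) [Field k] (a1 a2 : ℕ) : Type 1 where
  carrier : V a1 a2 → Type
  [acg : ∀ x, AddCommGroup (carrier x)]
  [mod : ∀ x, Module k (carrier x)]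
  fd : ∀ x, FiniteDimensional k (carrier x)
  map : ∀ (x y : V a1 a2), Arrow a1 a2 x y → (carrier x →ₗ[k] carrier y)

attribute [instance] Repn.acg Repn.mod

def HomSpace {k : Type} [Field k] {a1 a2 : ℕ} (ρ σ : Repn k a1 a2) :
    Submodule k (∀ x : V a1 a2, ρ.carrier x →ₗ[k] σ.carrier x) where
  carrier := {f | ∀ (x y : V a1 a2) (h : Arrow a1 a2 x y),
      (σ.map x y h).comp (f x) = (f y).comp (ρ.map x y h)}
  add_mem' := by
    intro f g hf hg
    intro x y h
    simp only [Pi.add_apply, LinearMap.comp_add, LinearMap.add_comp]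
    rw [hf x y h, hg x y h]
  zero_mem' := by
    intro x y h
    simp
  smul_mem' := by
    intro c f hf
    intro x y h
    simp only [Pi.smul_apply, LinearMap.comp_smul, LinearMap.smul_comp]
    rw [hf x y h]

def IsSubrep {k : Type} [Field k] {a1 a2 : ℕ} (ρ : Repn k a1 a2)
    (N : ∀ x, Submodule k (ρ.carrier x)) : Prop :=
  ∀ (x y : V a1 a2) (h : Arrow a1 a2 x y), ∀ v ∈ N x, ρ.map x y h v ∈ N y

open Classical in
noncomputable def sp (k : Type) [Field k] {a1 a2 : ℕ} (S : Set (V a1 a2)) (x : V a1 a2) :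
    Submodule k k :=
  if x ∈ S then ⊤ else ⊥

open Classical in
noncomputable def thinMap (k : Type) [Field k] {a1 a2 : ℕ} (S T : Set (V a1 a2))
    (x y : V a1 a2) : (sp k S x) →ₗ[k] (sp k T y) where
  toFun v := if h : y ∈ T then ⟨(v : k), by simp [sp, h]⟩ else 0
  map_add' u v := by
    by_cases h : y ∈ T
    · simp only [dif_pos h]
      exact Subtype.ext (by simp)
    · simp [dif_neg h]
  map_smul' c v := by
    by_cases h : y ∈ T
    · simp only [dif_pos h]
      exact Subtype.ext (by simp)
    · simp [dif_neg h]

noncomputable def thinRep (k : Type) [Field k] {a1 a2 : ℕ} (S : Set (V a1 a2)) :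
    Repn k a1 a2 where
  carrier x := ↥(sp k S x)
  acg := fun _ => inferInstance
  mod := fun _ => inferInstance
  fd := fun _ => inferInstance
  map x y _ := thinMap k S S x y

def suppR (a1 a2 : ℕ) (i : ℕ) : Set (V a1 a2) :=
  {x | match x with
      | .r j => (j : ℕ) ≠ i
      | .s _ => i ≠ a2
      | .t _ => i ≠ 0}

def suppS (a1 a2 : ℕ) (i : ℕ) : Set (V a1 a2) :=
  {x | match x with
      | .r j => (j : ℕ) < a2
      | .s _ => False
      | .t j => (j : ℕ) + 1 < i}

def suppT (a1 a2 : ℕ) (i : ℕ) : Set (V a1 a2) :=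
  {x | match x with
      | .r j => 1 ≤ (j : ℕ)
      | .s j => i ≤ (j : ℕ)
      | .t _ => False}

noncomputable def Mr (k : Type) [Field k] (a1 a2 : ℕ) (i : ℕ) : Repn k a1 a2 :=
  thinRep k (suppR a1 a2 i)

noncomputable def Ms (k : Type) [Field k] (a1 a2 : ℕ) (i : ℕ) : Repn k a1 a2 :=
  thinRep k (suppS a1 a2 i)

noncomputable def Mt (k : Type) [Field k] (a1 a2 : ℕ) (i : ℕ) : Repn k a1 a2 :=
  thinRep k (suppT a1 a2 i)

noncomputable def Mv (k : Type) [Field k] (a1 a2 : ℕ) : V a1 a2 → Repn k a1 a2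
  | .r j => Mr k a1 a2 (j : ℕ)
  | .s j => Ms k a1 a2 ((j : ℕ) + 1)
  | .t j => Mt k a1 a2 ((j : ℕ) + 1)

def inA (i j n : ℕ) : Prop := (i < j ∧ i < n ∧ n < j) ∨ (j ≤ i ∧ (i < n ∨ n < j))

def inW (a1 a2 i j : ℕ) : V a1 a2 → Prop
  | .r n => inA i j n
  | .s _ => inA i j a2
  | .t _ => inA i j 0

structure IsG (k : Type) [Field k] (a1 a2 i j : ℕ) (g : V a1 a2 → k) : Prop where
  z1 : ∀ x, x ∉ suppR a1 a2 i → g x = 0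
  z2 : ∀ x, x ∉ suppR a1 a2 j → g x = 0
  ar : ∀ x y, Arrow a1 a2 x y → x ∈ suppR a1 a2 i → y ∈ suppR a1 a2 j → g x = g y

theorem G_const {k : Type} (G : ℕ → k) (a2 i j : ℕ)
    (hs : ∀ n, n + 1 ≤ a2 → n ≠ i → n + 1 ≠ j → G n = G (n + 1)) (m n : ℕ) (hmn : m ≤ n) :
    n ≤ a2 → (∀ l, m ≤ l → l < n → l ≠ i ∧ l + 1 ≠ j) → G m = G n := by
  induction n, hmn using Nat.le_induction with
  | base => intros; rfl
  | succ n hmn ih =>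
    intro hn h
    rw [ih (by omega) (fun l h1 h2 => h l h1 (by omega))]
    have := h n hmn (by omega)
    exact hs n hn this.1 this.2

open Classical in
theorem G_formula {k : Type} [Field k] (G : ℕ → k) (a2 i j : ℕ) (hi : i ≤ a2) (hj : j ≤ a2)
    (hs : ∀ n, n + 1 ≤ a2 → n ≠ i → n + 1 ≠ j → G n = G (n + 1))
    (hc : i ≠ a2 → j ≠ 0 → G a2 = G 0) (hGj : G j = 0)
    (n : ℕ) (hn : n ≤ a2) : G n = if inA i j n then G ((i + 1) % (a2 + 1)) else 0 := by
  have C := G_const G a2 i j hs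
  have hmod : i < a2 → (i + 1) % (a2 + 1) = i + 1 := fun h => Nat.mod_eq_of_lt (by omega)
  split_ifs with h
  · rcases h with ⟨h1, h2, h3⟩ | ⟨h1, h2 | h2⟩
    · rw [hmod (by omega)]
      exact (C (i+1) n (by omega) hn (by omega)).symm
    · rw [hmod (by omega)]
      exact (C (i+1) n (by omega) hn (by omega)).symm
    · rw [← C 0 n (by omega) hn (by omega)]
      by_cases hia : i = a2
      · subst hia; simp
      · rw [hmod (by omega), C (i+1) a2 (by omega) le_rfl (by omega)]
        exact (hc hia (by omega)).symm
  · unfold inA at h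
    by_cases hij : i < j
    · by_cases hnj : j ≤ n
      · rw [← C j n hnj hn (by omega), hGj]
      · rw [← C 0 n (by omega) hn (by omega), ← hc (by omega) (by omega),
          ← C j a2 hj le_rfl (by omega), hGj]
    · rw [← C j n (by omega) hn (by omega), hGj]

open Classical in
theorem g_formula {k : Type} [Field k] {a1 a2 i j : ℕ} (hi : i ≤ a2) (hj : j ≤ a2)
    {g : V a1 a2 → k} (hg : IsG k a1 a2 i j g) (x : V a1 a2) :
    g x = if inW a1 a2 i j x then
      g (.r ⟨(i + 1) % (a2 + 1), Nat.mod_lt _ (by omega)⟩) else 0 := by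
  obtain ⟨z1, z2, ar⟩ := hg
  let G : ℕ → k := fun n => if h : n < a2 + 1 then g (.r ⟨n, h⟩) else 0
  have Gr : ∀ n (h : n < a2 + 1), G n = g (.r ⟨n, h⟩) := fun n h => dif_pos h
  have GG := G_formula G a2 i j hi hj
    (fun n h1 h2 h3 => by
      rw [Gr n (by omega), Gr (n+1) (by omega)]
      exact ar _ _ (Or.inl rfl) h2 h3)
    (fun h1 h2 => by
      rw [Gr a2 (by omega), Gr 0 (by omega)]
      exact ar _ _ (Or.inr ⟨rfl, rfl⟩) (Ne.symm h1) (Ne.symm h2))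
    (by rw [Gr j (by omega)]; exact z2 _ (fun h => h rfl))
  rw [← Gr]
  have Gi : G i = 0 := by rw [Gr i (by omega)]; exact z1 _ (fun h => h rfl)
  have Gj : G j = 0 := by rw [Gr j (by omega)]; exact z2 _ (fun h => h rfl)
  match x with
  | .r ⟨n, hn⟩ => rw [← Gr]; exact GG n (by omega)
  | .s ⟨m, hm⟩ =>
    refine Eq.trans ?_ (GG a2 le_rfl)
    by_cases h1 : i = a2
    · rw [z1 (.s ⟨m, hm⟩) (fun h => h h1), ← h1, Gi]
    by_cases h2 : j = a2
    · rw [z2 (.s ⟨m, hm⟩) (fun h => h h2), ← h2, Gj]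
    have key : ∀ e m (hm : m < a1 - 1), m + e + 1 = a1 - 1 → g (.s ⟨m, hm⟩) = G a2 := by
      intro e
      induction e with
      | zero =>
        intro m hm h
        rw [Gr a2 (by omega)]
        exact ar _ _ ⟨by simp only; omega, rfl⟩ h1 (Ne.symm h2)
      | succ e ih =>
        intro m hm h
        rw [← ih (m+1) (by omega) (by omega)]
        exact ar (.s ⟨m, hm⟩) (.s ⟨m+1, _⟩) rfl h1 h2
    exact key (a1 - 1 - 1 - m) m hm (by omega)
  | .t ⟨m, hm⟩ =>
    refine Eq.trans ?_ (GG 0 (by omega))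
    by_cases h1 : i = 0
    · rw [z1 (.t ⟨m, hm⟩) (fun h => h h1), ← h1, Gi]
    by_cases h2 : j = 0
    · rw [z2 (.t ⟨m, hm⟩) (fun h => h h2), ← h2, Gj]
    have key : ∀ m (hm : m < a1 - 1), g (.t ⟨m, hm⟩) = G 0 := by
      intro m
      induction m with
      | zero =>
        intro hm
        rw [Gr 0 (by omega)]
        exact (ar (.r ⟨0, by omega⟩) (.t ⟨0, hm⟩) ⟨rfl, rfl⟩ (Ne.symm h1) h2).symm
      | succ e ih =>
        intro hm
        rw [← ih (by omega)]
        exact (ar (.t ⟨e, _⟩) (.t ⟨e+1, hm⟩) rfl h1 h2).symm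
    exact key m hm

theorem inW_arrow {a1 a2 i j : ℕ} (hi : i ≤ a2) (hj : j ≤ a2) (x y : V a1 a2)
    (h : Arrow a1 a2 x y) (hx : x ∈ suppR a1 a2 i) (hy : y ∈ suppR a1 a2 j) :
    inW a1 a2 i j x ↔ inW a1 a2 i j y := by
  rcases x with ⟨n, hn⟩ | ⟨n, hn⟩ | ⟨n, hn⟩ <;> rcases y with ⟨m, hm⟩ | ⟨m, hm⟩ | ⟨m, hm⟩ <;>
    simp only [Arrow, suppR, inW, inA, Set.mem_ofPred_eq] at * <;> omega

theorem inW_supp {a1 a2 i j : ℕ} (hi : i ≤ a2) (hj : j ≤ a2) (x : V a1 a2)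
    (h : inW a1 a2 i j x) : x ∈ suppR a1 a2 i ∧ x ∈ suppR a1 a2 j := by
  rcases x with ⟨n, hn⟩ | ⟨n, hn⟩ | ⟨n, hn⟩ <;>
    simp only [suppR, inW, inA, Set.mem_ofPred_eq] at * <;> omega

theorem inW_self {a1 a2 i : ℕ} (hi : i ≤ a2) (x : V a1 a2)
    (h : x ∈ suppR a1 a2 i) : inW a1 a2 i i x := by
  rcases x with ⟨n, hn⟩ | ⟨n, hn⟩ | ⟨n, hn⟩ <;>
    simp only [suppR, inW, inA, Set.mem_ofPred_eq] at * <;> omega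

theorem inA_next {a2 i j : ℕ} (ha2 : 0 < a2) (hi : i ≤ a2) (hj : j ≤ a2) :
    inA i j ((i + 1) % (a2 + 1)) ↔ (i + 1) % (a2 + 1) ≠ j := by
  unfold inA
  by_cases h : i = a2
  · subst h; simp; omega
  · rw [Nat.mod_eq_of_lt (by omega)]; omega

theorem not_inW {a1 a2 i j : ℕ} (hi : i ≤ a2) (hj : j ≤ a2)
    (h : (i + 1) % (a2 + 1) = j) (x : V a1 a2) : ¬ inW a1 a2 i j x := by
  have h' : (i = a2 ∧ j = 0) ∨ (i < a2 ∧ j = i + 1) := by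
    by_cases h1 : i = a2
    · subst h1; simp at h; omega
    · rw [Nat.mod_eq_of_lt (by omega)] at h; omega
  rcases x with ⟨n, hn⟩ | ⟨n, hn⟩ | ⟨n, hn⟩ <;>
    simp only [inW, inA] at * <;> omega

open Classical in
noncomputable def ee (k : Type) [Field k] {a1 a2 : ℕ} (S : Set (V a1 a2)) (x : V a1 a2) :
    sp k S x := ⟨if x ∈ S then 1 else 0, by
    by_cases h : x ∈ S
    · rw [sp, if_pos h]; exact Submodule.mem_top
    · rw [if_neg h]; exact Submodule.zero_mem _⟩

theorem sp_zero {k : Type} [Field k] {a1 a2 : ℕ} {S : Set (V a1 a2)} {x : V a1 a2}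
    (h : x ∉ S) (v : sp k S x) : (v : k) = 0 := by
  have := v.2
  simpa [sp, h] using this

theorem ee_eq {k : Type} [Field k] {a1 a2 : ℕ} {S : Set (V a1 a2)} {x : V a1 a2}
    (v : sp k S x) : v = (v : k) • ee k S x := by
  apply Subtype.ext
  by_cases h : x ∈ S
  · simp [ee, h]
  · simp [sp_zero h v]

theorem thinMap_val {k : Type} [Field k] {a1 a2 : ℕ} {S T : Set (V a1 a2)} {x y : V a1 a2}
    (h : y ∈ T) (v : sp k S x) : ((thinMap k S T x y v : sp k T y) : k) = v := by
  simp [thinMap, h]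

noncomputable def toG {k : Type} [Field k] {a1 a2 : ℕ} {S T : Set (V a1 a2)}
    (f : ∀ x, sp k S x →ₗ[k] sp k T x) (x : V a1 a2) : k := (f x (ee k S x) : k)

theorem f_eq {k : Type} [Field k] {a1 a2 : ℕ} {S T : Set (V a1 a2)}
    (f : ∀ x, sp k S x →ₗ[k] sp k T x) (x : V a1 a2) (v : sp k S x) :
    (f x v : k) = v * toG f x := by
  conv_lhs => rw [ee_eq v]
  rw [map_smul]; rfl

theorem toG_isG {k : Type} [Field k] {a1 a2 i j : ℕ}
    (f : ∀ x, sp k (suppR a1 a2 i) x →ₗ[k] sp k (suppR a1 a2 j) x)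
    (hf : f ∈ HomSpace (Mr k a1 a2 i) (Mr k a1 a2 j)) : IsG k a1 a2 i j (toG f) where
  z1 x hx := by
    have : ee k (suppR a1 a2 i) x = 0 := Subtype.ext (sp_zero hx _)
    simp [toG, this]
  z2 x hx := sp_zero hx _
  ar x y h hx hy := by
    have h1 : thinMap k (suppR a1 a2 j) (suppR a1 a2 j) x y (f x (ee k _ x)) =
      f y (thinMap k (suppR a1 a2 i) (suppR a1 a2 i) x y (ee k _ x)) :=
      LinearMap.congr_fun (hf x y h) (ee k (suppR a1 a2 i) x)
    have h2 := congrArg (Subtype.val) h1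
    rw [thinMap_val hy, f_eq f y] at h2
    change toG f x = _ at h2
    rw [h2]
    by_cases hy' : y ∈ suppR a1 a2 i
    · rw [thinMap_val hy']; simp [ee, hx]
    · have : ee k (suppR a1 a2 i) y = 0 := Subtype.ext (sp_zero hy' _)
      simp [toG, this]

open Classical in
noncomputable def f0 (k : Type) [Field k] (a1 a2 i j : ℕ) (x : V a1 a2) :
    sp k (suppR a1 a2 i) x →ₗ[k] sp k (suppR a1 a2 j) x :=
  if inW a1 a2 i j x then thinMap k _ _ x x else 0

open Classical in
theorem f0_val {k : Type} [Field k] {a1 a2 i j : ℕ} (hi : i ≤ a2) (hj : j ≤ a2) (x : V a1 a2)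
    (v : sp k (suppR a1 a2 i) x) :
    (f0 k a1 a2 i j x v : k) = if inW a1 a2 i j x then (v : k) else 0 := by
  unfold f0
  split_ifs with h
  · exact thinMap_val (inW_supp hi hj x h).2 v
  · rfl

theorem f0_mem {k : Type} [Field k] {a1 a2 i j : ℕ} (hi : i ≤ a2) (hj : j ≤ a2) :
    f0 k a1 a2 i j ∈ HomSpace (Mr k a1 a2 i) (Mr k a1 a2 j) := by
  intro x y h
  apply LinearMap.ext
  intro v
  change sp k (suppR a1 a2 i) x at v
  change thinMap k (suppR a1 a2 j) (suppR a1 a2 j) x y (f0 k a1 a2 i j x v) =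
      f0 k a1 a2 i j y (thinMap k (suppR a1 a2 i) (suppR a1 a2 i) x y v)
  apply Subtype.ext
  by_cases hy : y ∈ suppR a1 a2 j
  · rw [thinMap_val hy, f0_val hi hj, f0_val hi hj]
    by_cases hx : x ∈ suppR a1 a2 i
    · have := inW_arrow hi hj x y h hx hy
      by_cases hw : inW a1 a2 i j y
      · rw [if_pos (this.2 hw), if_pos hw, thinMap_val (inW_supp hi hj y hw).1]
      · rw [if_neg hw, if_neg (fun h => hw (this.1 h))]
    · have hv : v = 0 := Subtype.ext (sp_zero hx v)
      simp [hv]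
  · rw [sp_zero hy, sp_zero hy]

/-- For `0 ≤ i, j ≤ a2`, `Hom(M(r_i), M(r_j))` is zero if `j ≡ i + 1 (mod a2+1)`
and one-dimensional otherwise.  In particular every endomorphism of `M(r_i)` is a scalar
multiple of the identity. -/
theorem statement10 (k : Type) [Field k] (a1 a2 : ℕ) (ha1 : 0 < a1) (ha2 : 0 < a2)
    (i j : ℕ) (hi : i ≤ a2) (hj : j ≤ a2) :
    (((i + 1) % (a2 + 1) = j) → HomSpace (Mr k a1 a2 i) (Mr k a1 a2 j) = ⊥) ∧
    (((i + 1) % (a2 + 1) ≠ j) →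
      Module.finrank k ↥(HomSpace (Mr k a1 a2 i) (Mr k a1 a2 j)) = 1) ∧
    (∀ f ∈ HomSpace (Mr k a1 a2 i) (Mr k a1 a2 i),
      ∃ c : k, ∀ (x : V a1 a2) (v : (Mr k a1 a2 i).carrier x), f x v = c • v) := by
  have key : ∀ j, j ≤ a2 → ∀ f : (∀ x, sp k (suppR a1 a2 i) x →ₗ[k] sp k (suppR a1 a2 j) x),
      f ∈ HomSpace (Mr k a1 a2 i) (Mr k a1 a2 j) →
      ∃ c : k, ∀ x v, (f x v : k) = c * (f0 k a1 a2 i j x v : k) := by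
    intro j hj f hf
    refine ⟨toG f (.r ⟨(i + 1) % (a2 + 1), Nat.mod_lt _ (by omega)⟩), fun x v => ?_⟩
    rw [f_eq, f0_val hi hj, g_formula hi hj (toG_isG f hf) x]
    split_ifs <;> ring
  refine ⟨fun h => ?_, fun h => ?_, fun f hf => ?_⟩
  · rw [eq_bot_iff]
    intro f hf
    obtain ⟨c, hc⟩ := key j hj f hf
    rw [Submodule.mem_bot]
    funext x
    apply LinearMap.ext
    intro v
    apply Subtype.ext
    refine (hc x v).trans ?_
    have h3 := f0_val hi hj x (v : sp k (suppR a1 a2 i) x)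
    rw [if_neg (not_inW hi hj h x)] at h3
    exact (congrArg (c * ·) h3).trans (mul_zero c)
  · refine finrank_eq_one (⟨f0 k a1 a2 i j, f0_mem hi hj⟩ :
      HomSpace (Mr k a1 a2 i) (Mr k a1 a2 j)) ?_ ?_
    · intro h0
      have h1 : f0 k a1 a2 i j = fun _ => 0 := congrArg Subtype.val h0
      let x : V a1 a2 := .r ⟨(i + 1) % (a2 + 1), Nat.mod_lt _ (by omega)⟩
      have hw : inW a1 a2 i j x := (inA_next ha2 hi hj).2 h
      have h2 := f0_val hi hj x (ee k (suppR a1 a2 i) x)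
      rw [if_pos hw, h1] at h2
      simp [ee, (inW_supp hi hj x hw).1] at h2
    · rintro ⟨f, hf⟩
      obtain ⟨c, hc⟩ := key j hj f hf
      refine ⟨c, Subtype.ext ?_⟩
      funext x
      apply LinearMap.ext
      intro v
      apply Subtype.ext
      exact (hc x v).symm
  · obtain ⟨c, hc⟩ := key i hi f hf
    refine ⟨c, fun x v => ?_⟩
    apply Subtype.ext
    refine (hc x v).trans ?_
    change c * _ = c * (v : sp k (suppR a1 a2 i) x).1
    refine congrArg (c * ·) ((f0_val hi hi x v).trans ?_)
    split_ifs with hw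
    · rfl
    · exact (sp_zero (fun h => hw (inW_self hi x h)) v).symm
end

section
/- For all i, j with 0 ≤ i ≤ a2 and 1 ≤ j ≤ a1−1, every morphism of representations M(s_j) → M(r_i) is zero, i.e. Hom(M(s_j), M(r_i)) = 0. -/
theorem aux_fwd {k : Type} [Field k] {a1 a2 : ℕ} {S T : Set (V a1 a2)}
    (f : ∀ x : V a1 a2, (sp k S x) →ₗ[k] (sp k T x)) {x y : V a1 a2}
    (h : (thinMap k T T x y).comp (f x) = (f y).comp (thinMap k S S x y))
    (hx : x ∈ S) (hy : y ∈ S) (h0 : f x = 0) : f y = 0 := by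
  ext v
  have hv : (v : k) ∈ sp k S x := by simp [sp, hx]
  have h1 := LinearMap.congr_fun h ⟨(v : k), hv⟩
  have h2 : thinMap k S S x y ⟨(v : k), hv⟩ = v := by
    simp [thinMap, hy]
  rw [LinearMap.comp_apply, LinearMap.comp_apply, h2, h0] at h1
  rw [← h1]
  simp

theorem aux_bwd {k : Type} [Field k] {a1 a2 : ℕ} {S T : Set (V a1 a2)}
    (f : ∀ x : V a1 a2, (sp k S x) →ₗ[k] (sp k T x)) {x y : V a1 a2}
    (h : (thinMap k T T x y).comp (f x) = (f y).comp (thinMap k S S x y))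
    (hy : y ∈ T) (h0 : f y = 0) : f x = 0 := by
  ext v
  have h1 := LinearMap.congr_fun h v
  rw [LinearMap.comp_apply, LinearMap.comp_apply, h0] at h1
  have h2 := congrArg Subtype.val h1
  simpa [thinMap, hy] using h2

theorem aux_src {k : Type} [Field k] {a1 a2 : ℕ} {S T : Set (V a1 a2)}
    (f : ∀ x : V a1 a2, (sp k S x) →ₗ[k] (sp k T x)) {x : V a1 a2}
    (hx : x ∉ S) : f x = 0 := by
  ext v
  have h1 : v = 0 := by
    have hv : ∀ w ∈ sp k S x, w = 0 := by
      intro w hw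
      simpa [sp, hx] using hw
    exact Subtype.ext (hv v.1 v.2)
  simp [h1]

theorem aux_tgt {k : Type} [Field k] {a1 a2 : ℕ} {S T : Set (V a1 a2)}
    (f : ∀ x : V a1 a2, (sp k S x) →ₗ[k] (sp k T x)) {x : V a1 a2}
    (hx : x ∉ T) : f x = 0 := by
  ext v
  have hv : ∀ w ∈ sp k T x, w = 0 := by
    intro w hw
    simpa [sp, hx] using hw
  exact hv _ (f x v).2

theorem aux_main (k : Type) [Field k] (a1 a2 : ℕ) (ha2 : 0 < a2)
    (i j : ℕ) (hj1 : 1 ≤ j) (hj2 : j ≤ a1 - 1)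
    (f : ∀ x : V a1 a2, (sp k (suppS a1 a2 j) x) →ₗ[k] (sp k (suppR a1 a2 i) x))
    (hf : ∀ x y, Arrow a1 a2 x y → (thinMap k (suppR a1 a2 i) (suppR a1 a2 i) x y).comp (f x)
      = (f y).comp (thinMap k (suppS a1 a2 j) (suppS a1 a2 j) x y)) (x : V a1 a2) : f x = 0 := by
  have ht : ∀ (d n : ℕ) (hn : n < a1 - 1), j ≤ n + 1 + d → f (.t ⟨n, hn⟩) = 0 := by
    intro d
    by_cases hi : i = 0
    · intro n hn _
      exact aux_tgt f (by simp [suppR, hi])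
    induction d with
    | zero =>
      intro n hn h
      exact aux_src f (by simp [suppS]; omega)
    | succ d ih =>
      intro n hn h
      by_cases h' : j ≤ n + 1
      · exact aux_src f (by simp [suppS]; omega)
      · exact aux_bwd f (hf (.t ⟨n, hn⟩) (.t ⟨n + 1, by omega⟩) (by simp [Arrow]))
          (by simp [suppR, hi]) (ih _ _ (by omega))
  have hr : ∀ (n : ℕ) (hn : n < a2 + 1), f (.r ⟨n, hn⟩) = 0 := by
    intro n
    induction n with
    | zero =>
      intro hn
      by_cases hi : i = 0
      · exact aux_tgt f (by simp [suppR, hi])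
      · exact aux_bwd f (hf (.r ⟨0, hn⟩) (.t ⟨0, by omega⟩) (by simp [Arrow]))
          (by simp [suppR, hi]) (ht j _ _ (by omega))
    | succ n ih =>
      intro hn
      by_cases h : n + 1 < a2
      · exact aux_fwd f (hf (.r ⟨n, by omega⟩) (.r ⟨n + 1, hn⟩) (by simp [Arrow]))
          (by simp [suppS]; omega) (by simp [suppS]; omega) (ih _)
      · exact aux_src f (by simp [suppS]; omega)
  match x with
  | .r n => exact hr n.1 n.2
  | .s n => exact aux_src f (by simp [suppS])
  | .t n => exact ht j n.1 n.2 (by omega)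

/-- For `0 ≤ i ≤ a2` and `1 ≤ j ≤ a1 - 1`, every morphism of representations
`M(s_j) → M(r_i)` is zero, i.e. `Hom(M(s_j), M(r_i)) = 0`. -/
theorem statement16 (k : Type) [Field k] (a1 a2 : ℕ) (ha1 : 0 < a1) (ha2 : 0 < a2)
    (i j : ℕ) (hi : i ≤ a2) (hj1 : 1 ≤ j) (hj2 : j ≤ a1 - 1) :
    HomSpace (Ms k a1 a2 j) (Mr k a1 a2 i) = ⊥ := by
  rw [eq_bot_iff]
  intro f hf
  rw [Submodule.mem_bot]
  funext x
  exact aux_main k a1 a2 ha2 i j hj1 hj2 f hf x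
end
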